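/- arXiv:1107.5806 — 2 statements merged into one kernel-verified Lean document; each statement's English description precedes it below -/
import Mathlib

section
/- Let (X,Y,W,Z) be random variables on finite sets with joint distribution p(x,y,w,z). Then W satisfies H(f(X,Y,Z)|X,W,Z) = 0 and the Markov chain (X,Z) − Y − W, if and only if Y ∈ S_Y(W) ∈ M(Γ(G_{Y|X,Z})) and the Markov chain (X,Z) − Y − S_Y(W) holds. -/
open Finset

attribute [local instance] Classical.propDecidable

noncomputable section

/-- Probability of an event under a probability mass function on a finite sample space. -/
def pr {Ω : Type} [Fintype Ω] (μ : Ω → ℝ) (E : Set Ω) : ℝ :=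
  ∑ ω, if ω ∈ E then μ ω else 0

/-- The distribution (law) of a random variable `X` under `μ`. -/
def law {Ω 𝒜 : Type} [Fintype Ω] (μ : Ω → ℝ) (X : Ω → 𝒜) : 𝒜 → ℝ :=
  fun a => pr μ {ω | X ω = a}

/-- Shannon entropy (base 2) of a discrete random variable. -/
def ent {Ω 𝒜 : Type} [Fintype Ω] [Fintype 𝒜] (μ : Ω → ℝ) (X : Ω → 𝒜) : ℝ :=
  -∑ a, law μ X a * Real.logb 2 (law μ X a)

/-- Conditional entropy `H(X|Y) = H(X,Y) - H(Y)`. -/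
def condEnt {Ω 𝒜 ℬ : Type} [Fintype Ω] [Fintype 𝒜] [Fintype ℬ]
    (μ : Ω → ℝ) (X : Ω → 𝒜) (Y : Ω → ℬ) : ℝ :=
  ent μ (fun ω => (X ω, Y ω)) - ent μ Y

/-- Mutual information `I(X;Y)`. -/
def mutInf {Ω 𝒜 ℬ : Type} [Fintype Ω] [Fintype 𝒜] [Fintype ℬ]
    (μ : Ω → ℝ) (X : Ω → 𝒜) (Y : Ω → ℬ) : ℝ :=
  ent μ X + ent μ Y - ent μ (fun ω => (X ω, Y ω))

/-- Conditional mutual information `I(X;Y|Z)`. -/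
def condMutInf {Ω 𝒜 ℬ 𝒞 : Type} [Fintype Ω] [Fintype 𝒜] [Fintype ℬ] [Fintype 𝒞]
    (μ : Ω → ℝ) (X : Ω → 𝒜) (Y : Ω → ℬ) (Z : Ω → 𝒞) : ℝ :=
  condEnt μ X Z + condEnt μ Y Z - condEnt μ (fun ω => (X ω, Y ω)) Z

/-- Markov chain `U − V − W`: `U` and `W` are conditionally independent given `V`. -/
def MarkovChain {Ω 𝒜 ℬ 𝒞 : Type} [Fintype Ω]
    (μ : Ω → ℝ) (U : Ω → 𝒜) (V : Ω → ℬ) (W : Ω → 𝒞) : Prop :=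
  ∀ a b c, pr μ {ω | U ω = a ∧ V ω = b ∧ W ω = c} * pr μ {ω | V ω = b}
    = pr μ {ω | U ω = a ∧ V ω = b} * pr μ {ω | V ω = b ∧ W ω = c}

/-- `⌈2^{nR}⌉`, the number of messages available at blocklength `n` and rate `R`. -/
def codeSize (n : ℕ) (R : ℝ) : ℕ := Nat.ceil ((2 : ℝ) ^ ((n : ℝ) * R))

/-- The i.i.d. product mass function on sequences of length `n`. -/
def iid {𝒜 : Type} (p : 𝒜 → ℝ) (n : ℕ) : (Fin n → 𝒜) → ℝ :=
  fun s => ∏ i, p (s i)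

/-- A rate pair `(RX, RY)` is achievable for computing `f` at a receiver knowing `Z`,
from separate encodings of `X` and `Y`, when `(X,Y,Z) ~ p` i.i.d. -/
def Achievable {𝒳 𝒴 𝒵 F : Type} [Fintype 𝒳] [Fintype 𝒴] [Fintype 𝒵] [Fintype F]
    (p : 𝒳 × 𝒴 × 𝒵 → ℝ) (f : 𝒳 → 𝒴 → 𝒵 → F) (RX RY : ℝ) : Prop :=
  ∀ ε : ℝ, 0 < ε → ∃ N : ℕ, ∀ n, N ≤ n →
    ∃ (φX : (Fin n → 𝒳) → Fin (codeSize n RX))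
      (φY : (Fin n → 𝒴) → Fin (codeSize n RY))
      (ψ : Fin (codeSize n RX) → Fin (codeSize n RY) → (Fin n → 𝒵) → (Fin n → F)),
      pr (iid p n)
        {s | ψ (φX fun i => (s i).1) (φY fun i => (s i).2.1) (fun i => (s i).2.2)
            ≠ fun i => f (s i).1 (s i).2.1 (s i).2.2} ≤ ε

/-- The rate region: the closure of the set of achievable rate pairs. -/
def RateRegion {𝒳 𝒴 𝒵 F : Type} [Fintype 𝒳] [Fintype 𝒴] [Fintype 𝒵] [Fintype F]
    (p : 𝒳 × 𝒴 × 𝒵 → ℝ) (f : 𝒳 → 𝒴 → 𝒵 → F) : Set (ℝ × ℝ) :=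
  closure {r | Achievable p f r.1 r.2}

/-- Conditional characteristic graph adjacency of `A` given `C`, w.r.t. joint
weights `q` and function `g`. -/
def charAdj {𝒜 𝒞 F : Type} (q : 𝒜 → 𝒞 → ℝ) (g : 𝒜 → 𝒞 → F) (a₁ a₂ : 𝒜) : Prop :=
  a₁ ≠ a₂ ∧ ∃ c, 0 < q a₁ c * q a₂ c ∧ g a₁ c ≠ g a₂ c

/-- Adjacency of the conditional characteristic graph `G_{X|Y,Z}`. -/
def adjXgYZ {𝒳 𝒴 𝒵 F : Type} (p : 𝒳 × 𝒴 × 𝒵 → ℝ) (f : 𝒳 → 𝒴 → 𝒵 → F) : 𝒳 → 𝒳 → Prop :=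
  charAdj (fun x (c : 𝒴 × 𝒵) => p (x, c.1, c.2)) (fun x c => f x c.1 c.2)

/-- Adjacency of the conditional characteristic graph `G_{Y|X,Z}`. -/
def adjYgXZ {𝒳 𝒴 𝒵 F : Type} (p : 𝒳 × 𝒴 × 𝒵 → ℝ) (f : 𝒳 → 𝒴 → 𝒵 → F) : 𝒴 → 𝒴 → Prop :=
  charAdj (fun y (c : 𝒳 × 𝒵) => p (c.1, y, c.2)) (fun y c => f c.1 y c.2)

/-- Adjacency of the conditional characteristic graph `G_{X,Y|Z}`. -/
def adjXYgZ {𝒳 𝒴 𝒵 F : Type} (p : 𝒳 × 𝒴 × 𝒵 → ℝ) (f : 𝒳 → 𝒴 → 𝒵 → F) :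
    (𝒳 × 𝒴) → (𝒳 × 𝒴) → Prop :=
  charAdj (fun a (z : 𝒵) => p (a.1, a.2, z)) (fun a z => f a.1 a.2 z)

/-- `s` is an independent set of the graph with adjacency `adj`. -/
def IndepFinset {𝒜 : Type} (adj : 𝒜 → 𝒜 → Prop) (s : Finset 𝒜) : Prop :=
  ∀ a₁ ∈ s, ∀ a₂ ∈ s, ¬ adj a₁ a₂

/-- `s` is a maximal independent set of the graph with adjacency `adj`. -/
def MaxIndepFinset {𝒜 : Type} (adj : 𝒜 → 𝒜 → Prop) (s : Finset 𝒜) : Prop :=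
  IndepFinset adj s ∧ ∀ t, IndepFinset adj t → s ⊆ t → t = s

/-- Adjacency of the generalized conditional characteristic graph `G_{Y|V,Z}` (a graph on
the values of `Y`): `y₁ ∼ y₂` iff they are distinct and there are `v, z` with
`p(v,y₁,z)·p(v,y₂,z) > 0` on which the function `f̃_X` (computed through the hidden
variable `X`) takes different values. -/
def genAdj {Ω 𝒱 𝒳 𝒴 𝒵 F : Type} [Fintype Ω] (μ : Ω → ℝ)
    (V : Ω → 𝒱) (X : Ω → 𝒳) (Y : Ω → 𝒴) (Z : Ω → 𝒵) (f : 𝒳 → 𝒴 → 𝒵 → F)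
    (y₁ y₂ : 𝒴) : Prop :=
  y₁ ≠ y₂ ∧ ∃ v z x₁ x₂,
    0 < pr μ {ω | V ω = v ∧ X ω = x₁ ∧ Y ω = y₁ ∧ Z ω = z} ∧
    0 < pr μ {ω | V ω = v ∧ X ω = x₂ ∧ Y ω = y₂ ∧ Z ω = z} ∧
    f x₁ y₁ z ≠ f x₂ y₂ z

/-- Conditional graph entropy `H_G(A|C)`: the infimum of `I(V;A|C)` over all joint
distributions `μ` of `(V,A,C)` whose `(A,C)`-marginal is `q`, satisfying the Markov
chain `V − A − C` with `A ∈ V ∈ Γ*(G)`. -/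
def condGraphEnt {𝒜 𝒞 : Type} [Fintype 𝒜] [Fintype 𝒞]
    (adj : 𝒜 → 𝒜 → Prop) (q : 𝒜 × 𝒞 → ℝ) : ℝ :=
  sInf { r : ℝ | ∃ μ : Finset 𝒜 × 𝒜 × 𝒞 → ℝ,
    (∀ a, 0 ≤ μ a) ∧ (∑ a, μ a = 1) ∧
    (∀ x c, (∑ v, μ (v, x, c)) = q (x, c)) ∧
    MarkovChain μ (fun a => a.1) (fun a => a.2.1) (fun a => a.2.2) ∧
    (∀ v x c, 0 < μ (v, x, c) → x ∈ v) ∧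
    (∀ v x c, 0 < μ (v, x, c) → MaxIndepFinset adj v) ∧
    r = condMutInf μ (fun a => a.1) (fun a => a.2.1) (fun a => a.2.2) }

/-- The support set `{x : p(v,x) > 0}` attached to an index `v` of `V`. -/
def suppSet {Ω 𝒱 𝒜 : Type} [Fintype Ω] [Fintype 𝒜] (μ : Ω → ℝ)
    (V : Ω → 𝒱) (X : Ω → 𝒜) (v : 𝒱) : Finset 𝒜 :=
  Finset.univ.filter (fun x => 0 < pr μ {ω | V ω = v ∧ X ω = x})

/-- The support-set random variable `S_X(V) = (V, {x : p(V,x) > 0})`. -/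
def suppVar {Ω 𝒱 𝒜 : Type} [Fintype Ω] [Fintype 𝒜] (μ : Ω → ℝ)
    (V : Ω → 𝒱) (X : Ω → 𝒜) : Ω → 𝒱 × Finset 𝒜 :=
  fun ω => (V ω, suppSet μ V X (V ω))

section Pr

variable {Ω 𝒜 ℬ : Type} [Fintype Ω] {μ : Ω → ℝ}

theorem pr_nonneg (hμ : ∀ ω, 0 ≤ μ ω) (E : Set Ω) : 0 ≤ pr μ E :=
  Finset.sum_nonneg fun ω _ => by split_ifs <;> simp [hμ]

theorem pr_congr {E E' : Set Ω} (h : ∀ ω, μ ω ≠ 0 → (ω ∈ E ↔ ω ∈ E')) : pr μ E = pr μ E' := by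
  refine Finset.sum_congr rfl fun ω _ => ?_
  by_cases hω : μ ω = 0
  · simp [hω]
  · simp only [h ω hω]

theorem pr_mono (hμ : ∀ ω, 0 ≤ μ ω) {E E' : Set Ω} (h : E ⊆ E') : pr μ E ≤ pr μ E' := by
  refine Finset.sum_le_sum fun ω _ => ?_
  by_cases h₁ : ω ∈ E
  · simp [h₁, h h₁]
  · simp only [h₁, if_false]
    split_ifs <;> simp [hμ]

theorem pr_pos_iff (hμ : ∀ ω, 0 ≤ μ ω) (E : Set Ω) : 0 < pr μ E ↔ ∃ ω ∈ E, 0 < μ ω := by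
  constructor
  · intro h
    obtain ⟨ω, -, hω⟩ := Finset.exists_lt_of_sum_lt
        (show ∑ _ω : Ω, (0 : ℝ) < ∑ ω, if ω ∈ E then μ ω else 0 from
        Finset.sum_const_zero.trans_lt h)
    by_cases hE : ω ∈ E
    · exact ⟨ω, hE, by simpa [hE] using hω⟩
    · simp [hE] at hω
  · rintro ⟨ω, hE, hω⟩
    refine Finset.sum_pos' (fun ω _ => by split_ifs <;> simp [hμ]) ⟨ω, Finset.mem_univ _, ?_⟩
    simpa [hE] using hω

theorem pr_lt_pr (hμ : ∀ ω, 0 ≤ μ ω) {E E' : Set Ω} (h : E ⊆ E') {ω : Ω}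
    (hE' : ω ∈ E') (hE : ω ∉ E) (hω : 0 < μ ω) : pr μ E < pr μ E' := by
  refine Finset.sum_lt_sum (fun ω _ => ?_) ⟨ω, Finset.mem_univ _, by simpa [hE, hE'] using hω⟩
  by_cases h₁ : ω ∈ E
  · simp [h₁, h h₁]
  · simp only [h₁, if_false]
    split_ifs <;> simp [hμ]

theorem sum_law_prod [Fintype 𝒜] (X : Ω → 𝒜) (Y : Ω → ℬ) (b : ℬ) :
    ∑ a, law μ (fun ω => (X ω, Y ω)) (a, b) = law μ Y b := by
  unfold law pr
  rw [Finset.sum_comm]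
  refine Finset.sum_congr rfl fun ω _ => ?_
  by_cases h : Y ω = b <;> simp [h]

theorem law_prod_le (hμ : ∀ ω, 0 ≤ μ ω) (X : Ω → 𝒜) (Y : Ω → ℬ) (a : 𝒜) (b : ℬ) :
    law μ (fun ω => (X ω, Y ω)) (a, b) ≤ law μ Y b :=
  pr_mono hμ fun ω hω => by
    simp only [Set.mem_ofPred_eq, Prod.mk.injEq] at hω
    exact hω.2

theorem condEnt_eq_sum [Fintype 𝒜] [Fintype ℬ] (X : Ω → 𝒜) (Y : Ω → ℬ) :
    condEnt μ X Y = ∑ c : 𝒜 × ℬ, law μ (fun ω => (X ω, Y ω)) c *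
      (Real.logb 2 (law μ Y c.2) - Real.logb 2 (law μ (fun ω => (X ω, Y ω)) c)) := by
  have h : ∑ b, law μ Y b * Real.logb 2 (law μ Y b) =
      ∑ c : 𝒜 × ℬ, law μ (fun ω => (X ω, Y ω)) c * Real.logb 2 (law μ Y c.2) := by
    rw [Fintype.sum_prod_type_right]
    refine Finset.sum_congr rfl fun b _ => ?_
    simp only [← Finset.sum_mul, sum_law_prod]
  simp only [condEnt, ent, mul_sub, Finset.sum_sub_distrib, h]
  ring

/-- `H(X|Y) = 0` iff `X` is almost surely a function of `Y`. -/
theorem condEnt_eq_zero_iff [Fintype 𝒜] [Fintype ℬ] (hμ : ∀ ω, 0 ≤ μ ω)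
    (X : Ω → 𝒜) (Y : Ω → ℬ) :
    condEnt μ X Y = 0 ↔ ∀ ω ω', 0 < μ ω → 0 < μ ω' → Y ω = Y ω' → X ω = X ω' := by
  have hpos : ∀ ω, 0 < μ ω → 0 < law μ (fun ω => (X ω, Y ω)) (X ω, Y ω) := fun ω hω =>
    (pr_pos_iff hμ _).2 ⟨ω, rfl, hω⟩
  rw [condEnt_eq_sum, Finset.sum_eq_zero_iff_of_nonneg]
  · constructor
    · intro h ω ω' hω hω' hY
      by_contra hX
      have h₁ := hpos ω hω
      have hlt : law μ (fun ω => (X ω, Y ω)) (X ω, Y ω) < law μ Y (Y ω) := by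
        refine pr_lt_pr hμ (ω := ω') (fun a ha => ?_) hY.symm (fun ha => ?_) hω'
        · exact congrArg Prod.snd ha
        · exact hX (congrArg Prod.fst ha).symm
      have hlog := Real.logb_lt_logb (b := 2) (by norm_num) h₁ hlt
      exact (mul_pos h₁ (sub_pos.2 hlog)).ne' (h (X ω, Y ω) (Finset.mem_univ _))
    · rintro h ⟨a, b⟩ -
      rcases (pr_nonneg hμ {ω | (X ω, Y ω) = (a, b)}).eq_or_lt' with h₀ | h₀
      · exact mul_eq_zero_of_left h₀ _
      · obtain ⟨ω, hω, hpω⟩ := (pr_pos_iff hμ _).1 h₀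
        simp only [Set.mem_ofPred_eq, Prod.mk.injEq] at hω
        have heq : law μ Y b = law μ (fun ω => (X ω, Y ω)) (a, b) := by
          refine pr_congr fun ω' hω' => ?_
          simp only [Set.mem_ofPred_eq, Prod.mk.injEq]
          refine ⟨fun hb => ⟨?_, hb⟩, And.right⟩
          rw [← hω.1]
          exact h ω' ω ((hμ ω').lt_of_ne' hω') hpω (hb.trans hω.2.symm)
        simp [heq]
  · rintro ⟨a, b⟩ -
    rcases (pr_nonneg hμ {ω | (X ω, Y ω) = (a, b)}).eq_or_lt' with h₀ | h₀
    · exact (mul_eq_zero_of_left h₀ _).ge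
    · exact mul_nonneg h₀.le (sub_nonneg.2
        (Real.logb_le_logb_of_le (by norm_num) h₀ (law_prod_le hμ X Y a b)))

theorem mem_suppSet [Fintype 𝒜] (hμ : ∀ ω, 0 ≤ μ ω) (V : Ω → ℬ) (X : Ω → 𝒜) (v : ℬ) (x : 𝒜) :
    x ∈ suppSet μ V X v ↔ ∃ ω, V ω = v ∧ X ω = x ∧ 0 < μ ω := by
  simp [suppSet, pr_pos_iff hμ, and_assoc]

theorem pr_mem_suppVar [Fintype 𝒜] (hμ : ∀ ω, 0 ≤ μ ω) (V : Ω → ℬ) (X : Ω → 𝒜) :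
    pr μ {ω | X ω ∈ (suppVar μ V X ω).2} = ∑ ω, μ ω := by
  have h : pr μ {ω | X ω ∈ (suppVar μ V X ω).2} = pr μ Set.univ := by
    refine pr_congr fun ω hω => ⟨fun _ => trivial, fun _ => ?_⟩
    exact (mem_suppSet hμ V X _ _).2 ⟨ω, rfl, rfl, (hμ ω).lt_of_ne' hω⟩
  rw [h]
  simp [pr]

/-- The support-set variable carries its index, so it is a relabelling of `W`. -/
theorem markovChain_suppVar_iff {𝒰 𝒱 : Type} [Fintype 𝒜] (U : Ω → 𝒰) (V : Ω → 𝒱)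
    (W : Ω → ℬ) (Y : Ω → 𝒜) :
    MarkovChain μ U V (suppVar μ W Y) ↔ MarkovChain μ U V W := by
  have key : ∀ ω w, suppVar μ W Y ω = (w, suppSet μ W Y w) ↔ W ω = w := by
    intro ω w
    simp only [suppVar, Prod.mk.injEq, and_iff_left_iff_imp]
    rintro rfl
    rfl
  constructor
  · intro h a b w
    simpa only [key] using h a b (w, suppSet μ W Y w)
  · rintro h a b ⟨w, s⟩
    by_cases hs : s = suppSet μ W Y w
    · subst hs
      simpa only [key] using h a b w
    · have hne : ∀ ω, suppVar μ W Y ω ≠ (w, s) := by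
        intro ω hω
        simp only [suppVar, Prod.mk.injEq] at hω
        exact hs (by rw [← hω.2, hω.1])
      simp [hne, pr]

end Pr

/-- Corollary 2: for `(X,Y,W,Z) ~ p` on the canonical sample space,
`H(f(X,Y,Z)|X,W,Z) = 0` together with the Markov chain `(X,Z) − Y − W` holds iff
`Y ∈ S_Y(W) ∈ M(Γ(G_{Y|X,Z}))` and the Markov chain `(X,Z) − Y − S_Y(W)` holds. -/
theorem zero_entropy_markov_iff_support_sets_VeqX
    (𝒳 𝒴 𝒲 𝒵 F : Type)
    [Fintype 𝒳] [Fintype 𝒴] [Fintype 𝒲] [Fintype 𝒵] [Fintype F]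
    (p : 𝒳 × 𝒴 × 𝒲 × 𝒵 → ℝ) (hp0 : ∀ a, 0 ≤ p a) (hp1 : ∑ a, p a = 1)
    (f : 𝒳 → 𝒴 → 𝒵 → F) :
    (condEnt p (fun a => f a.1 a.2.1 a.2.2.2)
        (fun a => (a.1, a.2.2.1, a.2.2.2)) = 0 ∧
      MarkovChain p (fun a => (a.1, a.2.2.2)) (fun a => a.2.1) (fun a => a.2.2.1))
    ↔
    -- Y ∈ S_Y(W)
    (pr p {a | a.2.1 ∈ (suppVar p (fun b => b.2.2.1) (fun b => b.2.1) a).2} = 1 ∧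
      -- S_Y(W) ∈ M(Γ(G_{Y|X,Z}))
      (∀ w, IndepFinset
        (adjYgXZ (law p (fun a => (a.1, a.2.1, a.2.2.2))) f)
        (suppSet p (fun a => a.2.2.1) (fun a => a.2.1) w)) ∧
      -- (X,Z) − Y − S_Y(W)
      MarkovChain p (fun a => (a.1, a.2.2.2)) (fun a => a.2.1)
        (suppVar p (fun a => a.2.2.1) (fun a => a.2.1))) := by
  rw [condEnt_eq_zero_iff hp0, markovChain_suppVar_iff, pr_mem_suppVar hp0, hp1]
  constructor
  · rintro ⟨hf, hM⟩
    refine ⟨rfl, fun w y₁ hy₁ y₂ hy₂ hadj => ?_, hM⟩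
    obtain ⟨-, ⟨x, z⟩, hq, hne⟩ := hadj
    have hpt : ∀ y, y ∈ suppSet p (fun a => a.2.2.1) (fun a => a.2.1) w →
        law p (fun a => (a.1, a.2.1, a.2.2.2)) (x, y, z) ≠ 0 → 0 < p (x, y, w, z) := by
      intro y hy hxyz
      obtain ⟨ω, hW, hY, hω⟩ := (mem_suppSet hp0 _ _ _ _).1 hy
      obtain ⟨ω', hω', hpω'⟩ :=
        (pr_pos_iff hp0 _).1 ((pr_nonneg hp0 _).lt_of_ne' hxyz)
      simp only [Set.mem_ofPred_eq, Prod.mk.injEq] at hω'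
      have h₁ : 0 < pr p {a | (a.1, a.2.2.2) = (x, z) ∧ a.2.1 = y} :=
        (pr_pos_iff hp0 _).2 ⟨ω', ⟨Prod.ext hω'.1 hω'.2.2, hω'.2.1⟩, hpω'⟩
      have h₂ : 0 < pr p {a | a.2.1 = y ∧ a.2.2.1 = w} :=
        (pr_pos_iff hp0 _).2 ⟨ω, ⟨hY, hW⟩, hω⟩
      have h₃ := (mul_pos h₁ h₂).trans_eq (hM (x, z) y w).symm
      obtain ⟨⟨x', y', w', z'⟩, ha, hpa⟩ :=
        (pr_pos_iff hp0 _).1 (pos_of_mul_pos_left h₃ (pr_nonneg hp0 _))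
      simp only [Set.mem_ofPred_eq, Prod.mk.injEq] at ha
      obtain ⟨⟨rfl, rfl⟩, rfl, rfl⟩ := ha
      exact hpa
    exact hne (hf (x, y₁, w, z) (x, y₂, w, z) (hpt y₁ hy₁ (left_ne_zero_of_mul hq.ne'))
      (hpt y₂ hy₂ (right_ne_zero_of_mul hq.ne')) rfl)
  · rintro ⟨-, hI, hM⟩
    refine ⟨?_, hM⟩
    rintro ⟨x, y₁, w, z⟩ ⟨x', y₂, w', z'⟩ h₁ h₂ h
    simp only [Prod.mk.injEq] at h
    obtain ⟨rfl, rfl, rfl⟩ := h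
    by_contra hne
    refine hI w y₁ ((mem_suppSet hp0 _ _ _ _).2 ⟨_, rfl, rfl, h₁⟩)
      y₂ ((mem_suppSet hp0 _ _ _ _).2 ⟨_, rfl, rfl, h₂⟩)
      ⟨fun h => hne (by simp only [h]), (x, z), mul_pos ?_ ?_, hne⟩
    · exact (pr_pos_iff hp0 _).2 ⟨_, rfl, h₁⟩
    · exact (pr_pos_iff hp0 _).2 ⟨_, rfl, h₂⟩
end
end

section
/- Let X and Y be binary random variables with joint distribution P(X=0,Y=0) = P(X=1,Y=1) = p/2 and P(X=0,Y=1) = P(X=1,Y=0) = (1−p)/2 for some p ∈ (0,1), and let f(x,y) = x ⊕ y (sum modulo 2); there is no side information (Z is constant). Then for any random variables V and W jointly distributed with (X,Y) satisfying the Markov chains V − X − (Y,W) and (V,X) − Y − W, X ∈ V ∈ M(Γ(G_{X|Y})), and Y ∈ W ∈ M(Γ(G_{Y|V})), one has H(X|V) = 0, H(Y|W) = 0, H(X|W) = H(X|Y), and H(Y|V) = H(Y|X); consequently the inner-bound inequalities R_X ≥ H(X|W), R_Y ≥ H(Y|V), R_X + R_Y ≥ H(X) + H(Y|V) reduce to R_X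 ≥ H(X|Y), R_Y ≥ H(Y|X), R_X + R_Y ≥ H(X,Y). -/
open Finset

attribute [local instance] Classical.propDecidable

noncomputable section

section Probability

variable {Ω 𝒜 ℬ 𝒞 : Type} [Fintype Ω]

lemma pr_congr_of_pos {μ : Ω → ℝ} (hμ : ∀ ω, 0 ≤ μ ω) {E E' : Set Ω}
    (h : ∀ ω, 0 < μ ω → (ω ∈ E ↔ ω ∈ E')) : pr μ E = pr μ E' := by
  refine Finset.sum_congr rfl fun ω _ => ?_
  rcases (hμ ω).eq_or_lt with h0 | h0
  · simp [← h0]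
  · simp only [h ω h0]

lemma pr_pos_of_mem {μ : Ω → ℝ} (hμ : ∀ ω, 0 ≤ μ ω) {E : Set Ω} {ω : Ω}
    (h : 0 < μ ω) (hE : ω ∈ E) : 0 < pr μ E := by
  refine Finset.sum_pos' (fun i _ => ?_) ⟨ω, Finset.mem_univ _, by simpa [hE] using h⟩
  split_ifs
  exacts [hμ i, le_rfl]

lemma exists_pos_mem_of_pr_pos {μ : Ω → ℝ} {E : Set Ω} (h : 0 < pr μ E) :
    ∃ ω, 0 < μ ω ∧ ω ∈ E := by
  by_contra! hne
  refine h.not_ge (Finset.sum_nonpos fun ω _ => ?_)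
  split_ifs with hE
  · exact not_lt.mp fun hω => hne ω hω hE
  · exact le_rfl

lemma mem_of_pr_eq_one {μ : Ω → ℝ} (hμ : ∀ ω, 0 ≤ μ ω) (hμ1 : ∑ ω, μ ω = 1) {E : Set Ω}
    (h : pr μ E = 1) {ω : Ω} (hω : 0 < μ ω) : ω ∈ E := by
  by_contra hE
  have hlt : pr μ E < ∑ ω, μ ω := by
    refine Finset.sum_lt_sum (fun i _ => ?_) ⟨ω, Finset.mem_univ _, by simpa [hE] using hω⟩
    split_ifs
    exacts [le_rfl, hμ i]
  linarith

lemma pr_map_eq_and [Fintype 𝒜] (μ : Ω → ℝ) (U : Ω → 𝒜) (f : 𝒜 → ℬ) (b : ℬ)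
    (P : Ω → Prop) :
    pr μ {ω | f (U ω) = b ∧ P ω} =
      ∑ a, if f a = b then pr μ {ω | U ω = a ∧ P ω} else 0 := by
  have key : ∀ a, (if f a = b then pr μ {ω | U ω = a ∧ P ω} else 0) =
      ∑ ω, if U ω = a then (if f (U ω) = b ∧ P ω then μ ω else 0) else 0 := by
    intro a
    split_ifs with h
    · refine Finset.sum_congr rfl fun ω _ => ?_
      by_cases hU : U ω = a
      · subst hU
        simp [h]
      · simp [hU]
    · refine (Finset.sum_eq_zero fun ω _ => ?_).symm
      by_cases hU : U ω = a
      · subst hU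
        simp [h]
      · simp [hU]
  simp_rw [key]
  rw [Finset.sum_comm]
  simp only [pr, Set.mem_ofPred_eq, Finset.sum_ite_eq, Finset.mem_univ, if_true]
  congr!

lemma sum_law_mul [Fintype 𝒜] (μ : Ω → ℝ) (X : Ω → 𝒜) (g : 𝒜 → ℝ) :
    ∑ a, law μ X a * g a = ∑ ω, μ ω * g (X ω) := by
  simp_rw [law, pr, Finset.sum_mul]
  rw [Finset.sum_comm]
  simp [ite_mul]

lemma ent_eq_sum [Fintype 𝒜] (μ : Ω → ℝ) (X : Ω → 𝒜) :
    ent μ X = -∑ ω, μ ω * Real.logb 2 (law μ X (X ω)) := by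
  rw [ent, sum_law_mul]

lemma ent_comp_of_injective [Fintype 𝒜] [Fintype ℬ] (μ : Ω → ℝ) (X : Ω → 𝒜) {f : 𝒜 → ℬ}
    (hf : Function.Injective f) : ent μ (fun ω => f (X ω)) = ent μ X := by
  simp [ent_eq_sum, law, hf.eq_iff]

lemma MarkovChain.symm {μ : Ω → ℝ} {U : Ω → 𝒜} {V : Ω → ℬ} {W : Ω → 𝒞}
    (h : MarkovChain μ U V W) : MarkovChain μ W V U := by
  intro c b a
  have h1 : {ω | W ω = c ∧ V ω = b ∧ U ω = a} = {ω | U ω = a ∧ V ω = b ∧ W ω = c} := by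
    ext ω
    simp only [Set.mem_ofPred_eq]
    tauto
  have h2 : {ω | W ω = c ∧ V ω = b} = {ω | V ω = b ∧ W ω = c} := by
    simp only [and_comm]
  have h3 : {ω | V ω = b ∧ U ω = a} = {ω | U ω = a ∧ V ω = b} := by
    simp only [and_comm]
  rw [h1, h2, h3, h a b c, mul_comm]

lemma MarkovChain.map_left {𝒟 : Type} [Fintype 𝒜] {μ : Ω → ℝ} {U : Ω → 𝒜} {V : Ω → ℬ}
    {W : Ω → 𝒞} (h : MarkovChain μ U V W) (f : 𝒜 → 𝒟) :
    MarkovChain μ (fun ω => f (U ω)) V W := by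
  intro d b c
  rw [pr_map_eq_and, pr_map_eq_and, Finset.sum_mul, Finset.sum_mul]
  refine Finset.sum_congr rfl fun a _ => ?_
  split_ifs
  · exact h a b c
  · simp

lemma markovChain_self (μ : Ω → ℝ) (S : Ω → 𝒜) (T : Ω → ℬ) : MarkovChain μ S S T := by
  intro a b c
  by_cases hab : a = b
  · subst hab
    simp only [← and_assoc, and_self]
    ring
  · have h1 : {ω | S ω = a ∧ S ω = b ∧ T ω = c} = ∅ := by
      ext ω
      simp only [Set.mem_ofPred_eq, Set.mem_empty_iff_false, iff_false]
      rintro ⟨rfl, rfl, -⟩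
      exact hab rfl
    have h2 : {ω | S ω = a ∧ S ω = b} = ∅ := by
      ext ω
      simp only [Set.mem_ofPred_eq, Set.mem_empty_iff_false, iff_false]
      rintro ⟨rfl, rfl⟩
      exact hab rfl
    rw [h1, h2]
    simp [pr]

/-- If `U − S − T` and `S` is almost surely a function of `T`, then `H(U|T) = H(U|S)`. -/
lemma MarkovChain.condEnt_eq [Fintype 𝒜] [Fintype ℬ] [Fintype 𝒞] {μ : Ω → ℝ}
    (hμ : ∀ ω, 0 ≤ μ ω) {U : Ω → 𝒜} {S : Ω → ℬ} {T : Ω → 𝒞} (h : MarkovChain μ U S T)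
    (hST : ∀ ω ω', 0 < μ ω → 0 < μ ω' → T ω = T ω' → S ω = S ω') :
    condEnt μ U T = condEnt μ U S := by
  suffices hsum : ∑ ω, μ ω * (Real.logb 2 (law μ (fun ω => (U ω, T ω)) (U ω, T ω)) +
        Real.logb 2 (law μ S (S ω))) =
      ∑ ω, μ ω * (Real.logb 2 (law μ (fun ω => (U ω, S ω)) (U ω, S ω)) +
        Real.logb 2 (law μ T (T ω))) by
    simp only [mul_add, Finset.sum_add_distrib] at hsum
    simp only [condEnt, ent_eq_sum]
    linarith
  refine Finset.sum_congr rfl fun ω _ => ?_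
  rcases (hμ ω).eq_or_lt with h0 | h0
  · simp [← h0]
  have hUT : pr μ {ω' | U ω' = U ω ∧ S ω' = S ω ∧ T ω' = T ω} =
      law μ (fun ω => (U ω, T ω)) (U ω, T ω) :=
    pr_congr_of_pos hμ fun ω' h0' => by
      have := hST ω' ω h0' h0
      simp only [Set.mem_ofPred_eq, Prod.mk.injEq]
      tauto
  have hT : pr μ {ω' | S ω' = S ω ∧ T ω' = T ω} = law μ T (T ω) :=
    pr_congr_of_pos hμ fun ω' h0' => by
      have := hST ω' ω h0' h0
      simp only [Set.mem_ofPred_eq]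
      tauto
  have hUS : pr μ {ω' | U ω' = U ω ∧ S ω' = S ω} =
      law μ (fun ω => (U ω, S ω)) (U ω, S ω) := by
    simp [law]
  have hmul := h (U ω) (S ω) (T ω)
  rw [hUT, hT, hUS] at hmul
  have hpos : ∀ {𝒟 : Type} (D : Ω → 𝒟), law μ D (D ω) ≠ 0 := fun D =>
    (pr_pos_of_mem hμ h0 (E := {ω' | D ω' = D ω}) rfl).ne'
  rw [← Real.logb_mul (hpos fun ω => (U ω, T ω)) (hpos S),
    ← Real.logb_mul (hpos fun ω => (U ω, S ω)) (hpos T)]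
  exact congrArg (fun r => μ ω * Real.logb 2 r) hmul

end Probability

lemma eq_of_mem_indepFinset {adj : Bool → Bool → Prop} (hadj : ∀ a b, a ≠ b → adj a b)
    {s : Finset Bool} (hs : IndepFinset adj s) {a b : Bool} (ha : a ∈ s) (hb : b ∈ s) :
    a = b := by
  by_contra hab
  exact hs a ha b hb (hadj a b hab)

/-- Example 2, Körner–Marton sum modulo 2: for binary `X, Y` with the
symmetric distribution `P(X=Y=b) = p/2`, `P(X≠Y) = (1-p)/2`, `p ∈ (0,1)`, `f = xor`,
and any `V, W` satisfying the Markov chains `V − X − (Y,W)` and `(V,X) − Y − W` with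
`X ∈ V ∈ M(Γ(G_{X|Y}))` and `Y ∈ W ∈ M(Γ(G_{Y|V}))`: one has `H(X|V) = 0`,
`H(Y|W) = 0`, `H(X|W) = H(X|Y)`, `H(Y|V) = H(Y|X)`, and the inner-bound inequalities
reduce to the Slepian–Wolf inequalities. -/
theorem korner_marton_example
    (Ω 𝒱 𝒲 : Type) [Fintype Ω] [Fintype 𝒱] [Fintype 𝒲]
    (μ : Ω → ℝ) (hμ0 : ∀ ω, 0 ≤ μ ω) (hμ1 : ∑ ω, μ ω = 1)
    (p : ℝ) (hp0 : 0 < p) (hp1 : p < 1)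
    (X : Ω → Bool) (Y : Ω → Bool) (V : Ω → 𝒱) (W : Ω → 𝒲)
    (A : 𝒱 → Finset Bool) (B : 𝒲 → Finset Bool)
    -- joint distribution of (X,Y)
    (hdist : ∀ x y : Bool,
      law μ (fun ω => (X ω, Y ω)) (x, y) = if x = y then p / 2 else (1 - p) / 2)
    -- Markov chains V − X − (Y,W) and (V,X) − Y − W
    (hMk1 : MarkovChain μ V X (fun ω => (Y ω, W ω)))
    (hMk2 : MarkovChain μ (fun ω => (V ω, X ω)) Y W)
    -- X ∈ V ∈ M(Γ(G_{X|Y})), for f(x,y) = x ⊕ y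
    (hVindep : ∀ v, IndepFinset
      (charAdj (fun x y => law μ (fun ω => (X ω, Y ω)) (x, y)) (fun x y => xor x y))
      (A v))
    (hXinV : pr μ {ω | X ω ∈ A (V ω)} = 1)
    -- Y ∈ W ∈ M(Γ(G_{Y|V}))
    (hWindep : ∀ w, IndepFinset
      (genAdj μ V X Y (fun _ => (() : Unit)) (fun x y _ => xor x y)) (B w))
    (hYinW : pr μ {ω | Y ω ∈ B (W ω)} = 1) :
    condEnt μ X V = 0 ∧
    condEnt μ Y W = 0 ∧
    condEnt μ X W = condEnt μ X Y ∧
    condEnt μ Y V = condEnt μ Y X ∧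
    ∀ RX RY : ℝ,
      (RX ≥ condEnt μ X W ∧ RY ≥ condEnt μ Y V ∧
        RX + RY ≥ ent μ X + condEnt μ Y V) ↔
      (RX ≥ condEnt μ X Y ∧ RY ≥ condEnt μ Y X ∧
        RX + RY ≥ ent μ (fun ω => (X ω, Y ω))) := by
  have hXYpos : ∀ x y : Bool, 0 < law μ (fun ω => (X ω, Y ω)) (x, y) := by
    intro x y
    rw [hdist]
    split_ifs <;> linarith
  have hXV : ∀ ω ω', 0 < μ ω → 0 < μ ω' → V ω = V ω' → X ω = X ω' := by
    intro ω ω' h h' hV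
    have hm : X ω ∈ A (V ω) := mem_of_pr_eq_one hμ0 hμ1 hXinV h
    have hm' : X ω' ∈ A (V ω') := mem_of_pr_eq_one hμ0 hμ1 hXinV h'
    rw [← hV] at hm'
    refine eq_of_mem_indepFinset (fun a b hab => ?_) (hVindep (V ω)) hm hm'
    exact ⟨hab, false, mul_pos (hXYpos _ _) (hXYpos _ _), by simpa using hab⟩
  have hYXV : MarkovChain μ Y X V := hMk1.symm.map_left Prod.fst
  have hXYW : MarkovChain μ X Y W := hMk2.map_left Prod.snd
  obtain ⟨ω₀, h₀, -⟩ := exists_pos_mem_of_pr_pos (hXYpos false false)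
  have hVXY : ∀ y, 0 < pr μ {ω | V ω = V ω₀ ∧ X ω = X ω₀ ∧ Y ω = y ∧ () = ()} := by
    intro y
    have hmul := hYXV y (X ω₀) (V ω₀)
    have h1 : 0 < pr μ {ω | Y ω = y ∧ X ω = X ω₀} := by
      simpa [law, and_comm] using hXYpos (X ω₀) y
    have h2 : 0 < pr μ {ω | X ω = X ω₀ ∧ V ω = V ω₀} := pr_pos_of_mem hμ0 h₀ ⟨rfl, rfl⟩
    have h3 : 0 < pr μ {ω | X ω = X ω₀} := pr_pos_of_mem hμ0 h₀ rfl
    have h4 : 0 < pr μ {ω | Y ω = y ∧ X ω = X ω₀ ∧ V ω = V ω₀} :=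
      pos_of_mul_pos_left (hmul ▸ mul_pos h1 h2) h3.le
    convert h4 using 3
    ext ω
    tauto
  have hYW : ∀ ω ω', 0 < μ ω → 0 < μ ω' → W ω = W ω' → Y ω = Y ω' := by
    intro ω ω' h h' hW
    have hm : Y ω ∈ B (W ω) := mem_of_pr_eq_one hμ0 hμ1 hYinW h
    have hm' : Y ω' ∈ B (W ω') := mem_of_pr_eq_one hμ0 hμ1 hYinW h'
    rw [← hW] at hm'
    refine eq_of_mem_indepFinset (fun a b hab => ?_) (hWindep (W ω)) hm hm'
    exact ⟨hab, V ω₀, (), X ω₀, X ω₀, hVXY a, hVXY b, by simpa using hab⟩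
  have hself : ∀ D : Ω → Bool, condEnt μ D D = 0 := fun D =>
    sub_eq_zero.mpr (ent_comp_of_injective μ D (f := fun d => (d, d))
      fun _ _ hd => congrArg Prod.fst hd)
  have hXW := hXYW.condEnt_eq hμ0 hYW
  have hYV := hYXV.condEnt_eq hμ0 hXV
  have hchain : ent μ X + condEnt μ Y X = ent μ (fun ω => (X ω, Y ω)) := by
    have hswap := ent_comp_of_injective μ (fun ω => (X ω, Y ω)) Prod.swap_injective
    simp only [Prod.swap_prod_mk] at hswap
    rw [condEnt, hswap]
    ring
  refine ⟨((markovChain_self μ X V).condEnt_eq hμ0 hXV).trans (hself X),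
    ((markovChain_self μ Y W).condEnt_eq hμ0 hYW).trans (hself Y), hXW, hYV, fun RX RY => ?_⟩
  rw [hXW, hYV, hchain]
end
end
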